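/- Let l₁, l₂, l₃ be three distinct lines in Pic S₈ that pairwise intersect in 1, and let l_a, l_b be lines with l_a·l_b = 0 and l₁ + l₂ + l₃ + K = l_a + l_b. Then: (1) the Gieser transform satisfies G_{l_a}(l_b) = 2(l_a − K) − (l₁ + l₂ + l₃); (2) G_{l_a}(l_b) is a line with G_{l_a}(l_b)·lᵢ = 1 for i = 1, 2, 3 and G_{l_a}(l_b)·l_a = 0, so that {l₁, l₂, l₃, G_{l_a}(l_b)} is a cornered A₃⁸(1)-polytope all of whose lines have intersection 0 with l_a; (3) B(G_{l_a}(l_b)) = G_{l_b}(l_a). -/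

import Mathlib

/-!
Picard lattice of the degree 1 del Pezzo surface S₈:
Pic S₈ = ℤh ⊕ ℤe₁ ⊕ ⋯ ⊕ ℤe₈ ≅ ℤ⁹, with intersection pairing
h·h = 1, h·eᵢ = 0, eᵢ·eⱼ = −δᵢⱼ, and canonical class K = −3h + e₁ + ⋯ + e₈.
-/

namespace DelPezzo

/-- The Picard lattice `Pic S₈ ≅ ℤ⁹`; coordinate `0` is the `h`-coordinate and
coordinates `1,…,8` are the `e₁,…,e₈`-coordinates. -/
abbrev Pic : Type := Fin 9 → ℤ

/-- The intersection pairing on `Pic S₈` (signature `(1,-8)`). -/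
def inter (x y : Pic) : ℤ := x 0 * y 0 - ∑ i : Fin 8, x i.succ * y i.succ

/-- The canonical class `K = -3h + e₁ + ⋯ + e₈`. -/
def K : Pic := fun i => if i = 0 then -3 else 1

/-- A line: a class `l` with `l·l = -1` and `l·K = -1`. -/
def IsLine (l : Pic) : Prop := inter l l = -1 ∧ inter l K = -1

/-- For lines `l, l'` with `l·l' = 0`, the Gieser transform of `l'` for `l`. -/
def G (l l' : Pic) : Pic := -K + l - l'

/-- The Bertini transform of a line. -/
def B (l : Pic) : Pic := -(2 • K) - l

theorem inter_comm (x y : Pic) : inter x y = inter y x := by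
  simp only [inter, mul_comm]

theorem inter_add_right (x y z : Pic) : inter x (y + z) = inter x y + inter x z := by
  simp only [inter, Pi.add_apply, mul_add, Finset.sum_add_distrib]
  ring

theorem inter_neg_right (x y : Pic) : inter x (-y) = -inter x y := by
  simp only [inter, Pi.neg_apply, mul_neg, Finset.sum_neg_distrib]
  ring

theorem inter_sub_right (x y z : Pic) : inter x (y - z) = inter x y - inter x z := by
  rw [sub_eq_add_neg, inter_add_right, inter_neg_right, sub_eq_add_neg]

theorem inter_add_left (x y z : Pic) : inter (x + y) z = inter x z + inter y z := by
  rw [inter_comm, inter_add_right, inter_comm z x, inter_comm z y]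

theorem inter_neg_left (x y : Pic) : inter (-x) y = -inter x y := by
  rw [inter_comm, inter_neg_right, inter_comm]

theorem inter_sub_left (x y z : Pic) : inter (x - y) z = inter x z - inter y z := by
  rw [sub_eq_add_neg, inter_add_left, inter_neg_left, sub_eq_add_neg]

theorem inter_K_K : inter K K = 1 := by decide

/-- The intersection pairing is negative definite on the orthogonal complement of `K`. -/
theorem eq_zero_of_inter_self_nonneg {d : Pic} (hK : inter d K = 0) (hd : 0 ≤ inter d d) :
    d = 0 := by
  have hsum : ∑ i : Fin 8, d i.succ = -3 * d 0 := by
    simp only [inter, K, if_true, Fin.succ_ne_zero, if_false, mul_one] at hK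
    linarith
  have hcs := sq_sum_le_card_mul_sum_sq (s := Finset.univ) (f := fun i : Fin 8 => d i.succ)
  simp only [inter, ← pow_two] at hd
  simp only [hsum, Finset.card_univ, Fintype.card_fin, Nat.cast_ofNat] at hcs
  have hzero : d 0 = 0 := by nlinarith [sq_nonneg (d 0)]
  have hnn : ∀ i ∈ Finset.univ, 0 ≤ d (Fin.succ (n := 8) i) ^ 2 := fun i _ => sq_nonneg _
  have hsq : ∑ i : Fin 8, d i.succ ^ 2 = 0 := by
    rw [hzero] at hd
    exact le_antisymm (by linarith) (Finset.sum_nonneg hnn)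
  rw [Finset.sum_eq_zero_iff_of_nonneg hnn] at hsq
  funext i
  refine Fin.cases hzero (fun j => ?_) i
  simpa using hsq j (Finset.mem_univ j)

/-- Distinct lines have nonnegative intersection. -/
theorem IsLine.inter_nonneg {l l' : Pic} (hl : IsLine l) (hl' : IsLine l') (hne : l ≠ l') :
    0 ≤ inter l l' := by
  by_contra! hlt
  refine hne (sub_eq_zero.mp (eq_zero_of_inter_self_nonneg ?_ ?_))
  · rw [inter_sub_left, hl.2, hl'.2, sub_self]
  · rw [inter_sub_left, inter_sub_right, inter_sub_right, hl.1, hl'.1, inter_comm l' l]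
    omega

theorem isLine_G {l l' : Pic} (hl : IsLine l) (hl' : IsLine l') (h : inter l l' = 0) :
    IsLine (G l l') := by
  have h' := inter_comm l' l
  have hK := inter_comm K l
  have hK' := inter_comm K l'
  obtain ⟨hl, hlK⟩ := hl
  obtain ⟨hl', hlK'⟩ := hl'
  have hKK := inter_K_K
  constructor <;>
  · simp only [G, inter_sub_left, inter_sub_right, inter_add_left, inter_add_right,
      inter_neg_left, inter_neg_right]
    omega

/-- A line meeting `la + lb` in `0` meets `la` nonnegatively when `la` and `lb` are skew. -/
theorem IsLine.inter_nonneg_of_skew_pair {l la lb : Pic} (hl : IsLine l) (hla : IsLine la)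
    (hab : inter la lb = 0) (h : inter l (la + lb) = 0) : 0 ≤ inter la l := by
  refine hla.inter_nonneg hl ?_
  rintro rfl
  rw [inter_add_right, hla.1, hab] at h
  omega

theorem IsLine.ne_of_inter_eq_one {l l' : Pic} (hl : IsLine l) (h : inter l' l = 1) :
    l' ≠ l := by
  rintro rfl
  have := hl.1
  omega

theorem gieser_of_skew_pair (l₁ l₂ l₃ la lb : Pic)
    (h₁ : IsLine l₁) (h₂ : IsLine l₂) (h₃ : IsLine l₃)
    (hne₁₂ : l₁ ≠ l₂) (hne₁₃ : l₁ ≠ l₃) (hne₂₃ : l₂ ≠ l₃)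
    (h₁₂ : inter l₁ l₂ = 1) (h₁₃ : inter l₁ l₃ = 1) (h₂₃ : inter l₂ l₃ = 1)
    (hla : IsLine la) (hlb : IsLine lb) (hab : inter la lb = 0)
    (hsum : l₁ + l₂ + l₃ + K = la + lb) :
    -- (1) the formula for the Gieser transform
    G la lb = 2 • (la - K) - (l₁ + l₂ + l₃) ∧
    -- (2) `{l₁, l₂, l₃, G la lb}` is a cornered `A₃⁸(1)`-polytope, all of whose
    -- lines have intersection `0` with `la`
    IsLine (G la lb) ∧
    inter (G la lb) l₁ = 1 ∧ inter (G la lb) l₂ = 1 ∧ inter (G la lb) l₃ = 1 ∧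
    G la lb ≠ l₁ ∧ G la lb ≠ l₂ ∧ G la lb ≠ l₃ ∧
    inter la l₁ = 0 ∧ inter la l₂ = 0 ∧ inter la l₃ = 0 ∧ inter la (G la lb) = 0 ∧
    -- (3) Bertini exchanges the two Gieser transforms
    B (G la lb) = G lb la := by
  have s₁ : inter l₁ (la + lb) = 0 := by
    simp only [← hsum, inter_add_right, h₁.1, h₁.2, h₁₂, h₁₃]; norm_num
  have s₂ : inter l₂ (la + lb) = 0 := by
    simp only [← hsum, inter_add_right, h₂.1, h₂.2, inter_comm l₂ l₁, h₁₂, h₂₃]; norm_num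
  have s₃ : inter l₃ (la + lb) = 0 := by
    simp only [← hsum, inter_add_right, h₃.1, h₃.2, inter_comm l₃ l₁, inter_comm l₃ l₂,
      h₁₃, h₂₃]
    norm_num
  have n₁ := h₁.inter_nonneg_of_skew_pair hla hab s₁
  have n₂ := h₂.inter_nonneg_of_skew_pair hla hab s₂
  have n₃ := h₃.inter_nonneg_of_skew_pair hla hab s₃
  have htot : inter la l₁ + inter la l₂ + inter la l₃ = 0 := by
    have h := congrArg (inter la) hsum
    simp only [inter_add_right, hla.1, hla.2, hab] at h
    omega
  have a₁ : inter la l₁ = 0 := by omega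
  have a₂ : inter la l₂ = 0 := by omega
  have a₃ : inter la l₃ = 0 := by omega
  have hG : ∀ l, IsLine l → inter l (la + lb) = 0 → inter la l = 0 → inter (G la lb) l = 1 := by
    intro l hl hs ha
    rw [inter_add_right, inter_comm l la, inter_comm l lb] at hs
    have hK := inter_comm K l
    have hlK := hl.2
    simp only [G, inter_sub_left, inter_add_left, inter_neg_left]
    omega
  have g₁ := hG l₁ h₁ s₁ a₁
  have g₂ := hG l₂ h₂ s₂ a₂
  have g₃ := hG l₃ h₃ s₃ a₃
  refine ⟨?_, isLine_G hla hlb hab, g₁, g₂, g₃, h₁.ne_of_inter_eq_one g₁,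
    h₂.ne_of_inter_eq_one g₂, h₃.ne_of_inter_eq_one g₃, a₁, a₂, a₃, ?_, ?_⟩
  · rw [eq_sub_of_add_eq hsum, G]
    module
  · simp only [G, inter_sub_right, inter_add_right, inter_neg_right, hla.1, hla.2, hab]
    norm_num
  · simp only [B, G]
    module

end DelPezzo
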